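/- Conservativity of the symplectic Q-matrices (corollary of the intertwinings of Sections 5.1–5.2, proved by induction on n starting from Q_1): for every k ≥ 1, every q = (q_1,…,q_k) ∈ (0,1)^k and every n ∈ {2k−1, 2k}, the matrix Q_n is a conservative Q-matrix on W_0^k; that is, all off-diagonal entries of Q_n are nonnegative and Σ_{x′ ∈ W_0^k} Q_n(x,x′) = 0 for every x ∈ W_0^k (each row has at most 2k+1 nonzero entries, so the sum is finite). -/

import Mathlib

open scoped BigOperators

noncomputable section

/-- Sum of the entries of an integer vector. -/
def vsum {n : ℕ} (z : Fin n → ℤ) : ℤ := ∑ i, z i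

/-- `Interlace x y` means `x ⪯ y`, i.e. `y_i ≤ x_i ≤ y_{i+1}` for `1 ≤ i ≤ n`. -/
def Interlace {n : ℕ} (x : Fin n → ℤ) (y : Fin (n + 1) → ℤ) : Prop :=
  ∀ i : Fin n, y i.castSucc ≤ x i ∧ x i ≤ y i.succ

/-- `PrecEq x x'` means `x ≺ x'`: `x_1 ≤ x'_1 ≤ x_2 ≤ x'_2 ≤ … ≤ x_k ≤ x'_k`. -/
def PrecEq {k : ℕ} (x x' : Fin k → ℤ) : Prop :=
  (∀ i, x i ≤ x' i) ∧ ∀ (i : ℕ) (h : i + 1 < k), x' ⟨i, Nat.lt_of_succ_lt h⟩ ≤ x ⟨i + 1, h⟩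

/-- Membership in `W₀^k = {0 ≤ z_1 ≤ z_2 ≤ ⋯ ≤ z_k}`. -/
def W0 {k : ℕ} (z : Fin k → ℤ) : Prop := Monotone z ∧ ∀ i, 0 ≤ z i

/-- `p` encodes an integer symplectic Gelfand–Tsetlin pattern with rows `1, …, n`,
row `r` having `⌈r/2⌉ = (r+1)/2` nonnegative entries `p r 0, …`; consecutive rows
satisfy `x^{2i-1} ≺ x^{2i}` and `x^{2i} ⪯ x^{2i+1}`; irrelevant entries are pinned to `0`. -/
def IsSymp (n : ℕ) (p : ℕ → ℕ → ℤ) : Prop :=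
  (∀ r i, 1 ≤ r → r ≤ n → i < (r + 1) / 2 → 0 ≤ p r i) ∧
  (∀ k, 1 ≤ k → 2 * k ≤ n →
    (∀ j, j < k → p (2 * k - 1) j ≤ p (2 * k) j) ∧
    (∀ j, j + 1 < k → p (2 * k) j ≤ p (2 * k - 1) (j + 1))) ∧
  (∀ k, 1 ≤ k → 2 * k + 1 ≤ n →
    (∀ j, j < k → p (2 * k + 1) j ≤ p (2 * k) j ∧ p (2 * k) j ≤ p (2 * k + 1) (j + 1))) ∧
  (∀ r i, r = 0 ∨ n < r ∨ (r + 1) / 2 ≤ i → p r i = 0)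

/-- `|x^r|`, the sum of the entries of row `r` (row `r` has `(r+1)/2` entries). -/
def rowSumS (p : ℕ → ℕ → ℤ) (r : ℕ) : ℤ := ∑ i ∈ Finset.range ((r + 1) / 2), p r i

/-- The geometric weight `w^q_n(x)`: each row `r` contributes
`q_{⌈r/2⌉}^{|x^r|−|x^{r−1}|}` if `r` is odd and `q_{r/2}^{−(|x^r|−|x^{r−1}|)}` if `r`
is even, which reproduces `w^q_{2k−1}` and `w^q_{2k}` (0-based rates). -/
def wSymp (n : ℕ) (q : ℕ → ℝ) (p : ℕ → ℕ → ℤ) : ℝ :=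
  ∏ r ∈ Finset.Icc 1 n,
    q ((r + 1) / 2 - 1) ^ ((if r % 2 = 1 then (1 : ℤ) else -1) * (rowSumS p r - rowSumS p (r - 1)))

/-- The symplectic Schur function `Sp^{2k−1}_z(q_1,…,q_k)`. -/
def SpOdd (k : ℕ) (q : ℕ → ℝ) (z : Fin k → ℤ) : ℝ :=
  ∑ᶠ p ∈ {p : ℕ → ℕ → ℤ | IsSymp (2 * k - 1) p ∧ ∀ i : Fin k, p (2 * k - 1) i = z i},
    wSymp (2 * k - 1) q p

/-- The symplectic Schur function `Sp^{2k}_z(q_1,…,q_k)`. -/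
def SpEven (k : ℕ) (q : ℕ → ℝ) (z : Fin k → ℤ) : ℝ :=
  ∑ᶠ p ∈ {p : ℕ → ℕ → ℤ | IsSymp (2 * k) p ∧ ∀ i : Fin k, p (2 * k) i = z i},
    wSymp (2 * k) q p

open Classical in
/-- The `Q`-matrix `Q_{2k−1}` on `W₀^k` (here `k = m+1`): jumps `x → x ± e_i` at rate
`Sp^{2k−1}_{x±e_i}(q)/Sp^{2k−1}_x(q)` whenever `x ± e_i ∈ W₀^k`, with diagonal
`−[Σ_{i=1}^{k−1}(q_i+q_i^{−1}) + q_k^{−1}·1{x_1>0} + q_k]`. -/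
def Qodd (m : ℕ) (q : ℕ → ℝ) (x x' : Fin (m + 1) → ℤ) : ℝ :=
  if x' = x then
    -((∑ i ∈ Finset.range m, (q i + (q i)⁻¹)) +
      (q m)⁻¹ * (if 0 < x 0 then 1 else 0) + q m)
  else if (∃ i, x' = x + Pi.single i 1 ∨ x' = x - Pi.single i 1) ∧ W0 x' then
    SpOdd (m + 1) q x' / SpOdd (m + 1) q x
  else 0

open Classical in
/-- The `Q`-matrix `Q_{2k}` on `W₀^k` (here `k = m+1`): jumps `x → x ± e_i` at rate
`Sp^{2k}_{x±e_i}(q)/Sp^{2k}_x(q)` whenever `x ± e_i ∈ W₀^k`, with diagonal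
`−Σ_{i=1}^{k}(q_i+q_i^{−1})`. -/
def Qeven (m : ℕ) (q : ℕ → ℝ) (x x' : Fin (m + 1) → ℤ) : ℝ :=
  if x' = x then -(∑ i ∈ Finset.range (m + 1), (q i + (q i)⁻¹))
  else if (∃ i, x' = x + Pi.single i 1 ∨ x' = x - Pi.single i 1) ∧ W0 x' then
    SpEven (m + 1) q x' / SpEven (m + 1) q x
  else 0

/-- The finite set of `y` interlacing with `w`, i.e. `w_i ≤ y_i ≤ w_{i+1}`. -/
def interlacingBox {k : ℕ} (w : Fin (k + 1) → ℤ) : Finset (Fin k → ℤ) :=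
  Finset.Icc (fun i => w i.castSucc) (fun i => w i.succ)

theorem mem_interlacingBox {k : ℕ} {w : Fin (k + 1) → ℤ} {y : Fin k → ℤ} :
    y ∈ interlacingBox w ↔ ∀ i, w i.castSucc ≤ y i ∧ y i ≤ w i.succ := by
  simp [interlacingBox, Pi.le_def, forall_and]

theorem interlacingBox_eq_empty {k : ℕ} {w : Fin (k + 1) → ℤ} (hw : ¬ Monotone w) :
    interlacingBox w = ∅ := by
  refine Finset.eq_empty_of_forall_notMem fun y hy => hw (Fin.monotone_iff_le_succ.2 fun i => ?_)
  exact (mem_interlacingBox.1 hy i).1.trans (mem_interlacingBox.1 hy i).2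

theorem vsum_add_single {k : ℕ} (z : Fin k → ℤ) (i : Fin k) (a : ℤ) :
    vsum (z + Pi.single i a) = vsum z + a := by
  simp [vsum, Finset.sum_add_distrib]

theorem vsum_sub_single {k : ℕ} (z : Fin k → ℤ) (i : Fin k) (a : ℤ) :
    vsum (z - Pi.single i a) = vsum z - a := by
  simp [vsum, Finset.sum_sub_distrib]

section Pointwise

variable {k : ℕ} {w : Fin (k + 1) → ℤ} {y : Fin k → ℤ}

theorem mem_box_add_castSucc_iff (hy : y ∈ interlacingBox w) (j : Fin k) :
    y ∈ interlacingBox (w + Pi.single j.castSucc 1) ↔ y - Pi.single j 1 ∈ interlacingBox w := by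
  simp only [mem_interlacingBox, Pi.add_apply, Pi.sub_apply, Pi.single_apply, Fin.ext_iff,
    Fin.val_castSucc, Fin.val_succ] at hy ⊢
  refine forall_congr' fun l => ?_
  have := hy l
  split_ifs <;> omega

theorem mem_box_add_last (hy : y ∈ interlacingBox w) :
    y ∈ interlacingBox (w + Pi.single (Fin.last k) 1) := by
  simp only [mem_interlacingBox, Pi.add_apply, Pi.single_apply, Fin.ext_iff,
    Fin.val_castSucc, Fin.val_succ, Fin.val_last] at hy ⊢
  intro l
  have := hy l
  split_ifs <;> omega

theorem mem_box_sub_succ_iff (hy : y ∈ interlacingBox w) (j : Fin k) :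
    y ∈ interlacingBox (w - Pi.single j.succ 1) ↔ y + Pi.single j 1 ∈ interlacingBox w := by
  simp only [mem_interlacingBox, Pi.add_apply, Pi.sub_apply, Pi.single_apply, Fin.ext_iff,
    Fin.val_castSucc, Fin.val_succ] at hy ⊢
  refine forall_congr' fun l => ?_
  have := hy l
  split_ifs <;> omega

theorem mem_box_sub_zero (hy : y ∈ interlacingBox w) :
    y ∈ interlacingBox (w - Pi.single 0 1) := by
  simp only [mem_interlacingBox, Pi.sub_apply, Pi.single_apply, Fin.ext_iff,
    Fin.val_castSucc, Fin.val_succ, Fin.val_zero, if_false, Nat.add_eq_zero_iff, one_ne_zero,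
    and_false] at hy ⊢
  intro l
  have := hy l
  split_ifs <;> omega

theorem mem_box_of_mem_box_add_zero (hy : y ∈ interlacingBox (w + Pi.single 0 1)) :
    y ∈ interlacingBox w := by
  simp only [mem_interlacingBox, Pi.add_apply, Pi.single_apply, Fin.ext_iff,
    Fin.val_castSucc, Fin.val_succ, Fin.val_zero, if_false, Nat.add_eq_zero_iff, one_ne_zero,
    and_false] at hy ⊢
  intro l
  have := hy l
  split_ifs at this <;> omega

theorem mem_box_of_mem_box_sub_last (hy : y ∈ interlacingBox (w - Pi.single (Fin.last k) 1)) :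
    y ∈ interlacingBox w := by
  simp only [mem_interlacingBox, Pi.sub_apply, Pi.single_apply, Fin.ext_iff,
    Fin.val_castSucc, Fin.val_succ, Fin.val_last] at hy ⊢
  intro l
  have := hy l
  split_ifs at this <;> omega

theorem mem_box_add_succ_iff (hw : Monotone w) (hm : Monotone y) (hy : y ∉ interlacingBox w)
    (j : Fin k) :
    y ∈ interlacingBox (w + Pi.single j.succ 1) ↔ y - Pi.single j 1 ∈ interlacingBox w := by
  have hwl := Fin.monotone_iff_le_succ.1 hw
  have hj : ∀ l : Fin k, (l : ℕ) = j + 1 → w l.castSucc = w j.succ ∧ y j ≤ y l := by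
    intro l hl
    exact ⟨congrArg w (Fin.ext (by simpa using hl)), hm (Fin.le_def.2 (by omega))⟩
  simp only [mem_interlacingBox, Pi.add_apply, Pi.sub_apply, Pi.single_apply, Fin.ext_iff,
    Fin.val_castSucc, Fin.val_succ, add_left_inj, not_forall] at hy ⊢
  obtain ⟨l₀, hl₀⟩ := hy
  constructor
  · intro h l
    have h0 := h l₀
    have hl := h l
    have hjj := h j
    have hwj := hwl j
    have key : (l₀ : ℕ) = j := by
      by_contra hne
      simp only [hne, if_false] at h0
      split_ifs at h0 <;> omega
    obtain rfl := Fin.ext key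
    by_cases e : (l : ℕ) = l₀
    · obtain rfl := Fin.ext e
      simp at hjj ⊢
      omega
    · simp only [e, if_false] at hl ⊢
      split_ifs at hl <;> omega
  · intro h l
    have h0 := h l₀
    have hl := h l
    have key : (l₀ : ℕ) = j := by
      by_contra hne
      simp only [hne, if_false] at h0
      omega
    obtain rfl := Fin.ext key
    simp only [if_true] at h0
    by_cases e : (l : ℕ) = l₀
    · obtain rfl := Fin.ext e
      simp
      omega
    · simp only [e, if_false] at hl ⊢
      split_ifs with h2
      · have := hj l h2
        omega
      · omega

theorem mem_box_sub_castSucc_iff (hw : Monotone w) (hm : Monotone y) (hy : y ∉ interlacingBox w)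
    (j : Fin k) :
    y ∈ interlacingBox (w - Pi.single j.castSucc 1) ↔ y + Pi.single j 1 ∈ interlacingBox w := by
  have hwl := Fin.monotone_iff_le_succ.1 hw
  have hj : ∀ l : Fin k, (l : ℕ) + 1 = j → w l.succ = w j.castSucc ∧ y l ≤ y j := by
    intro l hl
    exact ⟨congrArg w (Fin.ext (by simpa using hl)), hm (Fin.le_def.2 (by omega))⟩
  simp only [mem_interlacingBox, Pi.add_apply, Pi.sub_apply, Pi.single_apply, Fin.ext_iff,
    Fin.val_castSucc, Fin.val_succ, not_forall] at hy ⊢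
  obtain ⟨l₀, hl₀⟩ := hy
  constructor
  · intro h l
    have h0 := h l₀
    have hl := h l
    have hjj := h j
    have hwj := hwl j
    have key : (l₀ : ℕ) = j := by
      by_contra hne
      simp only [hne, if_false] at h0
      split_ifs at h0 <;> omega
    obtain rfl := Fin.ext key
    by_cases e : (l : ℕ) = l₀
    · obtain rfl := Fin.ext e
      simp at hjj ⊢
      omega
    · simp only [e, if_false] at hl ⊢
      split_ifs at hl <;> omega
  · intro h l
    have h0 := h l₀
    have hl := h l
    have key : (l₀ : ℕ) = j := by
      by_contra hne
      simp only [hne, if_false] at h0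
      omega
    obtain rfl := Fin.ext key
    simp only [if_true] at h0
    by_cases e : (l : ℕ) = l₀
    · obtain rfl := Fin.ext e
      simp
      omega
    · simp only [e, if_false] at hl ⊢
      split_ifs with h2
      · have := hj l h2
        omega
      · omega

end Pointwise

/-- The sum of `g` over the vectors interlacing with `w`. -/
def boxSum {k : ℕ} (g : (Fin k → ℤ) → ℝ) (w : Fin (k + 1) → ℤ) : ℝ :=
  ∑ y ∈ interlacingBox w, g y

section BoxSum

variable {k : ℕ} {g : (Fin k → ℤ) → ℝ} {w : Fin (k + 1) → ℤ}

theorem sum_eq_sum_ite_of_subset {α : Type*} [DecidableEq α] {s t : Finset α} (h : s ⊆ t)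
    (f : α → ℝ) : ∑ y ∈ s, f y = ∑ y ∈ t, if y ∈ s then f y else 0 := by
  rw [Finset.sum_ite_mem, Finset.inter_eq_right.2 h]

theorem sum_shift_eq_sum_ite {s t : Finset (Fin k → ℤ)} {v : Fin k → ℤ}
    (h : ∀ y ∈ s, y + v ∈ t) (f : (Fin k → ℤ) → ℝ) :
    ∑ y ∈ s, f (y + v) = ∑ y ∈ t, if y - v ∈ s then f y else 0 := by
  rw [← Finset.sum_filter]
  refine Finset.sum_nbij' (· + v) (· - v) ?_ ?_ ?_ ?_ ?_ <;> simp +contextual [h]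

theorem sum_boxSum_add_single (hg : ∀ y, ¬ Monotone y → g y = 0) (hw : Monotone w) :
    ∑ i, boxSum g (w + Pi.single i 1) =
      ∑ y ∈ interlacingBox w, ∑ j, g (y + Pi.single j 1) + boxSum g w := by
  set D : Finset (Fin k → ℤ) :=
    Finset.Icc (fun j => w j.castSucc - 1) (fun j => w j.succ + 1) with hD
  have hmem : ∀ y, y ∈ D ↔ ∀ i, w i.castSucc - 1 ≤ y i ∧ y i ≤ w i.succ + 1 := by
    simp [hD, Pi.le_def, forall_and]
  have h1 : ∀ i, interlacingBox (w + Pi.single i 1) ⊆ D := by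
    intro i y hy
    simp only [mem_interlacingBox, Pi.add_apply, Pi.single_apply] at hy
    refine (hmem y).2 fun l => ?_
    have := hy l
    split_ifs at this <;> omega
  have h2 : interlacingBox w ⊆ D := by
    intro y hy
    refine (hmem y).2 fun l => ?_
    have := mem_interlacingBox.1 hy l
    omega
  have h3 : ∀ j, ∀ y ∈ interlacingBox w, y + Pi.single j 1 ∈ D := by
    intro j y hy
    refine (hmem _).2 fun l => ?_
    have := mem_interlacingBox.1 hy l
    simp only [Pi.add_apply, Pi.single_apply]
    split_ifs <;> omega
  unfold boxSum
  rw [Finset.sum_comm, Finset.sum_congr rfl fun i _ => sum_eq_sum_ite_of_subset (h1 i) g,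
    Finset.sum_congr rfl fun j _ => sum_shift_eq_sum_ite (h3 j) g,
    sum_eq_sum_ite_of_subset h2 g, Finset.sum_comm,
    Finset.sum_comm (s := Finset.univ (α := Fin k)), ← Finset.sum_add_distrib]
  refine Finset.sum_congr rfl fun y _ => ?_
  by_cases hm : Monotone y
  · by_cases hy : y ∈ interlacingBox w
    · rw [Fin.sum_univ_castSucc]
      simp only [mem_box_add_castSucc_iff hy, mem_box_add_last hy, hy, if_true]
    · have h0 : y ∉ interlacingBox (w + Pi.single 0 1) :=
        fun h => hy (mem_box_of_mem_box_add_zero h)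
      rw [Fin.sum_univ_succ]
      simp only [mem_box_add_succ_iff hw hm hy, h0, hy, if_false, zero_add, add_zero]
  · simp [hg y hm]

theorem sum_boxSum_sub_single (hg : ∀ y, ¬ Monotone y → g y = 0) (hw : Monotone w) :
    ∑ i, boxSum g (w - Pi.single i 1) =
      ∑ y ∈ interlacingBox w, ∑ j, g (y - Pi.single j 1) + boxSum g w := by
  set D : Finset (Fin k → ℤ) :=
    Finset.Icc (fun j => w j.castSucc - 1) (fun j => w j.succ + 1) with hD
  have hmem : ∀ y, y ∈ D ↔ ∀ i, w i.castSucc - 1 ≤ y i ∧ y i ≤ w i.succ + 1 := by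
    simp [hD, Pi.le_def, forall_and]
  have h1 : ∀ i, interlacingBox (w - Pi.single i 1) ⊆ D := by
    intro i y hy
    simp only [mem_interlacingBox, Pi.sub_apply, Pi.single_apply] at hy
    refine (hmem y).2 fun l => ?_
    have := hy l
    split_ifs at this <;> omega
  have h2 : interlacingBox w ⊆ D := by
    intro y hy
    refine (hmem y).2 fun l => ?_
    have := mem_interlacingBox.1 hy l
    omega
  have h3 : ∀ j, ∀ y ∈ interlacingBox w, y + -Pi.single j 1 ∈ D := by
    intro j y hy
    refine (hmem _).2 fun l => ?_
    have := mem_interlacingBox.1 hy l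
    simp only [Pi.add_apply, Pi.neg_apply, Pi.single_apply]
    split_ifs <;> omega
  unfold boxSum
  simp only [sub_eq_add_neg (_ : Fin k → ℤ)]
  rw [Finset.sum_comm, Finset.sum_congr rfl fun i _ => sum_eq_sum_ite_of_subset (h1 i) g,
    Finset.sum_congr rfl fun j _ => sum_shift_eq_sum_ite (h3 j) g,
    sum_eq_sum_ite_of_subset h2 g, Finset.sum_comm,
    Finset.sum_comm (s := Finset.univ (α := Fin k)), ← Finset.sum_add_distrib]
  refine Finset.sum_congr rfl fun y _ => ?_
  simp only [sub_neg_eq_add]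
  by_cases hm : Monotone y
  · by_cases hy : y ∈ interlacingBox w
    · rw [Fin.sum_univ_succ, add_comm]
      simp only [mem_box_sub_succ_iff hy, mem_box_sub_zero hy, hy, if_true]
    · have h0 : y ∉ interlacingBox (w - Pi.single (Fin.last k) 1) :=
        fun h => hy (mem_box_of_mem_box_sub_last h)
      rw [Fin.sum_univ_castSucc]
      simp only [mem_box_sub_castSucc_iff hw hm hy, h0, hy, if_false, add_zero]
  · simp [hg y hm]

end BoxSum

/-- The integer vector `z` as a pattern row, padded with zeros. -/
def zeroExtend {k : ℕ} (z : Fin k → ℤ) : ℕ → ℤ := fun i => if h : i < k then z ⟨i, h⟩ else 0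

theorem zeroExtend_of_lt {k : ℕ} (z : Fin k → ℤ) {i : ℕ} (h : i < k) :
    zeroExtend z i = z ⟨i, h⟩ := dif_pos h

theorem zeroExtend_of_le {k : ℕ} (z : Fin k → ℤ) {i : ℕ} (h : k ≤ i) :
    zeroExtend z i = 0 := dif_neg (not_lt.2 h)

/-- Patterns with `2k+1` rows and top row `z`. -/
def oddPatterns (k : ℕ) (z : Fin (k + 1) → ℤ) : Set (ℕ → ℕ → ℤ) :=
  {p | IsSymp (2 * k + 1) p ∧ ∀ i : Fin (k + 1), p (2 * k + 1) i = z i}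

/-- Patterns with `2k` rows and top row `z`. -/
def evenPatterns (k : ℕ) (z : Fin k → ℤ) : Set (ℕ → ℕ → ℤ) :=
  {p | IsSymp (2 * k) p ∧ ∀ i : Fin k, p (2 * k) i = z i}

theorem SpOdd_succ_eq (k : ℕ) (q : ℕ → ℝ) (z : Fin (k + 1) → ℤ) :
    SpOdd (k + 1) q z = ∑ᶠ p ∈ oddPatterns k z, wSymp (2 * k + 1) q p := rfl

theorem SpEven_eq (k : ℕ) (q : ℕ → ℝ) (z : Fin k → ℤ) :
    SpEven k q z = ∑ᶠ p ∈ evenPatterns k z, wSymp (2 * k) q p := rfl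

theorem rowSumS_eq_vsum {k r : ℕ} (hr : (r + 1) / 2 = k) {p : ℕ → ℕ → ℤ} {y : Fin k → ℤ}
    (h : ∀ i : Fin k, p r i = y i) : rowSumS p r = vsum y := by
  simp [rowSumS, vsum, hr, Finset.sum_range, h]

theorem wSymp_update {k l n : ℕ} (hk : (n + 1) / 2 = k) (hl : (n + 2) / 2 = l) (q : ℕ → ℝ)
    {p : ℕ → ℕ → ℤ} {y : Fin k → ℤ} (h : ∀ i : Fin k, p n i = y i) (z : Fin l → ℤ) :
    wSymp (n + 1) q (Function.update p (n + 1) (zeroExtend z)) =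
      q (l - 1) ^ ((if (n + 1) % 2 = 1 then (1 : ℤ) else -1) * (vsum z - vsum y)) *
        wSymp n q p := by
  have hrow : ∀ r ≤ n, rowSumS (Function.update p (n + 1) (zeroExtend z)) r = rowSumS p r := by
    intro r hr
    simp [rowSumS, Function.update_of_ne (show r ≠ n + 1 by omega)]
  have htop : rowSumS (Function.update p (n + 1) (zeroExtend z)) (n + 1) = vsum z :=
    rowSumS_eq_vsum hl fun i => by simp [zeroExtend_of_lt z i.2]
  unfold wSymp
  rw [Finset.prod_Icc_succ_top (by omega), mul_comm, htop, Nat.add_sub_cancel, hrow n le_rfl,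
    rowSumS_eq_vsum hk h, show n + 1 + 1 = n + 2 from rfl, hl]
  congr 1
  refine Finset.prod_congr rfl fun r hr => ?_
  rw [Finset.mem_Icc] at hr
  rw [hrow r hr.2, hrow (r - 1) (by omega)]

theorem finsum_mem_update {k n : ℕ} {P : Set (ℕ → ℕ → ℤ)} {s : Finset (Fin k → ℤ)}
    {Q : (Fin k → ℤ) → Set (ℕ → ℕ → ℤ)} {v : ℕ → ℤ} {c : (Fin k → ℤ) → ℝ}
    {w w' : (ℕ → ℕ → ℤ) → ℝ} (hfin : ∀ y, (Q y).Finite)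
    (hrow : ∀ y, ∀ p ∈ Q y, ∀ i : Fin k, p n i = y i) (hzero : ∀ y, ∀ p ∈ Q y, p (n + 1) = 0)
    (hP : ∀ p, p ∈ P ↔ ∃ y ∈ s, ∃ p' ∈ Q y, Function.update p' (n + 1) v = p)
    (hw : ∀ y, ∀ p ∈ Q y, w (Function.update p (n + 1) v) = c y * w' p) :
    P.Finite ∧ ∑ᶠ p ∈ P, w p = ∑ y ∈ s, c y * ∑ᶠ p ∈ Q y, w' p := by
  have hPeq : P = ⋃ y ∈ (s : Set (Fin k → ℤ)), (fun p => Function.update p (n + 1) v) '' Q y := by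
    ext p
    simp [hP]
  have hfin' : ∀ y ∈ (s : Set (Fin k → ℤ)),
      ((fun p : ℕ → ℕ → ℤ => Function.update p (n + 1) v) '' Q y).Finite :=
    fun y _ => (hfin y).image _
  have hinj : ∀ y y', ∀ p ∈ Q y, ∀ p' ∈ Q y',
      Function.update p (n + 1) v = Function.update p' (n + 1) v → p = p' := by
    intro y y' p hp p' hp' h
    have h2 := congrArg (fun f => Function.update f (n + 1) 0) h
    simp only [Function.update_idem] at h2
    rwa [← hzero y p hp, Function.update_eq_self, hzero y p hp, ← hzero y' p' hp',
      Function.update_eq_self] at h2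
  have hdisj : (s : Set (Fin k → ℤ)).PairwiseDisjoint
      (fun y => (fun p : ℕ → ℕ → ℤ => Function.update p (n + 1) v) '' Q y) := by
    intro y _ y' _ hne
    refine Set.disjoint_left.2 ?_
    rintro _ ⟨p, hp, rfl⟩ ⟨p', hp', h⟩
    refine hne (funext fun i => ?_)
    rw [← hrow y p hp i, ← hrow y' p' hp' i, hinj y' y p' hp' p hp h]
  constructor
  · rw [hPeq]
    exact s.finite_toSet.biUnion hfin'
  · rw [hPeq, finsum_mem_biUnion hdisj s.finite_toSet hfin', finsum_mem_coe_finset]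
    refine Finset.sum_congr rfl fun y _ => ?_
    rw [finsum_mem_image fun p hp p' hp' h => hinj y y p hp p' hp' h,
      finsum_mem_congr rfl (hw y), ← mul_finsum_mem]

theorem mem_oddPatterns_iff {k : ℕ} {z : Fin (k + 1) → ℤ} (hz : 0 ≤ z 0) (p : ℕ → ℕ → ℤ) :
    p ∈ oddPatterns k z ↔ ∃ y ∈ interlacingBox z, ∃ p' ∈ evenPatterns k y,
      Function.update p' (2 * k + 1) (zeroExtend z) = p := by
  constructor
  · rintro ⟨⟨h1, h2, h3, h4⟩, hp⟩
    refine ⟨fun i => p (2 * k) i, mem_interlacingBox.2 fun i => ?_,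
      Function.update p (2 * k + 1) 0, ⟨⟨?_, ?_, ?_, ?_⟩, ?_⟩, ?_⟩
    · have := h3 k i.pos le_rfl i i.2
      rw [← hp, ← hp]
      exact this
    · intro r i h h' h''
      rw [Function.update_of_ne (by omega)]
      exact h1 r i h (by omega) h''
    · intro r h h'
      rw [Function.update_of_ne (by omega), Function.update_of_ne (by omega)]
      exact h2 r h (by omega)
    · intro r h h'
      rw [Function.update_of_ne (by omega), Function.update_of_ne (by omega)]
      exact h3 r h (by omega)
    · intro r i h
      by_cases hr : r = 2 * k + 1
      · simp [hr]
      · rw [Function.update_of_ne hr]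
        exact h4 r i (by omega)
    · intro i
      rw [Function.update_of_ne (by omega)]
    · rw [Function.update_idem, Function.update_eq_iff]
      refine ⟨funext fun i => ?_, fun _ _ => rfl⟩
      by_cases hi : i < k + 1
      · rw [zeroExtend_of_lt z hi, ← hp]
      · rw [zeroExtend_of_le z (by omega), h4 _ _ (by omega)]
  · rintro ⟨y, hy, p', ⟨⟨h1, h2, h3, h4⟩, hp⟩, rfl⟩
    have hy := mem_interlacingBox.1 hy
    refine ⟨⟨?_, ?_, ?_, ?_⟩, ?_⟩
    · intro r i h h' h''
      by_cases hr : r = 2 * k + 1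
      · subst hr
        rw [Function.update_self, zeroExtend_of_lt z (by omega)]
        rcases i with _ | i
        · exact hz
        · have hi : i < k := by omega
          refine le_trans ?_ (hy ⟨i, hi⟩).2
          rw [← hp]
          exact h1 _ _ (by omega) le_rfl (by simp; omega)
      · rw [Function.update_of_ne hr]
        exact h1 r i h (by omega) h''
    · intro r h h'
      rw [Function.update_of_ne (by omega), Function.update_of_ne (by omega)]
      exact h2 r h (by omega)
    · intro r h h' j hj
      rw [Function.update_of_ne (show 2 * r ≠ 2 * k + 1 by omega)]
      by_cases hr : r = k
      · subst hr
        rw [Function.update_self, zeroExtend_of_lt z (by omega), zeroExtend_of_lt z (by omega)]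
        have := hy ⟨j, hj⟩
        rw [← hp] at this
        exact this
      · rw [Function.update_of_ne (by omega)]
        exact h3 r h (by omega) j hj
    · intro r i h
      by_cases hr : r = 2 * k + 1
      · subst hr
        rw [Function.update_self, zeroExtend_of_le z (by omega)]
      · rw [Function.update_of_ne hr]
        exact h4 r i (by omega)
    · intro i
      rw [Function.update_self, zeroExtend_of_lt z i.2]

theorem mem_evenPatterns_succ_iff {k : ℕ} (z : Fin (k + 1) → ℤ) (p : ℕ → ℕ → ℤ) :
    p ∈ evenPatterns (k + 1) z ↔ ∃ y ∈ interlacingBox (Fin.cons 0 z), ∃ p' ∈ oddPatterns k y,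
      Function.update p' (2 * k + 1 + 1) (zeroExtend z) = p := by
  constructor
  · rintro ⟨⟨h1, h2, h3, h4⟩, hp⟩
    refine ⟨fun i => p (2 * k + 1) i, mem_interlacingBox.2 fun i => ?_,
      Function.update p (2 * k + 1 + 1) 0, ⟨⟨?_, ?_, ?_, ?_⟩, ?_⟩, ?_⟩
    · have h := h2 (k + 1) (by omega) le_rfl
      rw [Fin.cons_succ, ← hp]
      refine ⟨?_, h.1 i i.2⟩
      induction i using Fin.cases with
      | zero => exact h1 _ _ (by omega) (by omega) (by simp)
      | succ i =>
        rw [← Fin.succ_castSucc, Fin.cons_succ, ← hp]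
        exact h.2 i (by simp)
    · intro r i h h' h''
      rw [Function.update_of_ne (by omega)]
      exact h1 r i h (by omega) h''
    · intro r h h'
      rw [Function.update_of_ne (by omega), Function.update_of_ne (by omega)]
      exact h2 r h (by omega)
    · intro r h h'
      rw [Function.update_of_ne (by omega), Function.update_of_ne (by omega)]
      exact h3 r h (by omega)
    · intro r i h
      by_cases hr : r = 2 * k + 1 + 1
      · simp [hr]
      · rw [Function.update_of_ne hr]
        exact h4 r i (by omega)
    · intro i
      rw [Function.update_of_ne (by omega)]
    · rw [Function.update_idem, Function.update_eq_iff]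
      refine ⟨funext fun i => ?_, fun _ _ => rfl⟩
      by_cases hi : i < k + 1
      · rw [zeroExtend_of_lt z hi, ← hp]
        rfl
      · rw [zeroExtend_of_le z (by omega), h4 _ _ (by omega)]
  · rintro ⟨y, hy, p', ⟨⟨h1, h2, h3, h4⟩, hp⟩, rfl⟩
    have hy := mem_interlacingBox.1 hy
    refine ⟨⟨?_, ?_, ?_, ?_⟩, ?_⟩
    · intro r i h h' h''
      by_cases hr : r = 2 * k + 1 + 1
      · subst hr
        have hi : i < k + 1 := by omega
        rw [Function.update_self, zeroExtend_of_lt z hi]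
        refine le_trans ?_ (hy ⟨i, hi⟩).2
        rw [← hp]
        exact h1 _ _ (by omega) le_rfl (by simp; omega)
      · rw [Function.update_of_ne hr]
        exact h1 r i h (by omega) h''
    · intro r h h'
      rw [Function.update_of_ne (show 2 * r - 1 ≠ 2 * k + 1 + 1 by omega)]
      by_cases hr : r = k + 1
      · subst hr
        rw [show 2 * (k + 1) = 2 * k + 1 + 1 from rfl, Function.update_self]
        constructor
        · intro j hj
          rw [zeroExtend_of_lt z hj]
          have := (hy ⟨j, hj⟩).2
          rw [← hp] at this
          exact this
        · intro j hj
          rw [zeroExtend_of_lt z (by omega)]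
          have := (hy ⟨j + 1, hj⟩).1
          rw [← hp] at this
          exact this
      · rw [Function.update_of_ne (by omega)]
        exact h2 r h (by omega)
    · intro r h h'
      rw [Function.update_of_ne (by omega), Function.update_of_ne (by omega)]
      exact h3 r h (by omega)
    · intro r i h
      by_cases hr : r = 2 * k + 1 + 1
      · subst hr
        rw [Function.update_self, zeroExtend_of_le z (by omega)]
      · rw [Function.update_of_ne hr]
        exact h4 r i (by omega)
    · intro i
      rw [show 2 * (k + 1) = 2 * k + 1 + 1 from rfl, Function.update_self, zeroExtend_of_lt z i.2]

theorem oddPatterns_eq_empty {k : ℕ} {z : Fin (k + 1) → ℤ} (hz : ¬ W0 z) :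
    oddPatterns k z = ∅ := by
  refine Set.eq_empty_of_forall_notMem ?_
  rintro p ⟨⟨h1, h2, h3, h4⟩, hp⟩
  refine hz ⟨Fin.monotone_iff_le_succ.2 fun i => ?_, fun i => ?_⟩
  · have h := h3 k i.pos le_rfl i i.2
    rw [← hp, ← hp]
    exact h.1.trans h.2
  · rw [← hp]
    exact h1 _ _ (by omega) le_rfl (by omega)

theorem evenPatterns_zero (z : Fin 0 → ℤ) : evenPatterns 0 z = {0} := by
  ext p
  constructor
  · rintro ⟨⟨_, _, _, h4⟩, _⟩
    exact funext fun r => funext fun i => h4 r i (by omega)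
  · rintro rfl
    refine ⟨⟨?_, ?_, ?_, ?_⟩, fun i => i.elim0⟩ <;> intros <;> simp

theorem oddPatterns_finite_and_SpOdd_eq {k : ℕ} (hfin : ∀ y, (evenPatterns k y).Finite)
    (q : ℕ → ℝ) {z : Fin (k + 1) → ℤ} (hz : 0 ≤ z 0) : (oddPatterns k z).Finite ∧
      SpOdd (k + 1) q z =
        ∑ y ∈ interlacingBox z, q k ^ (vsum z - vsum y) * SpEven k q y := by
  simp only [SpOdd_succ_eq, SpEven_eq]
  refine finsum_mem_update hfin (fun y p hp => hp.2)
    (fun y p hp => funext fun i => hp.1.2.2.2 _ i (by omega)) (mem_oddPatterns_iff hz)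
    fun y p hp => ?_
  rw [wSymp_update (by omega) (by omega) q hp.2 z, if_pos (by omega), one_mul,
    Nat.add_sub_cancel]

theorem evenPatterns_finite_and_SpEven_eq {k : ℕ} (hfin : ∀ y, (oddPatterns k y).Finite)
    (q : ℕ → ℝ) (z : Fin (k + 1) → ℤ) : (evenPatterns (k + 1) z).Finite ∧
      SpEven (k + 1) q z =
        ∑ y ∈ interlacingBox (Fin.cons 0 z), q k ^ (vsum y - vsum z) * SpOdd (k + 1) q y := by
  simp only [SpOdd_succ_eq, SpEven_eq]
  refine finsum_mem_update hfin (fun y p hp => hp.2)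
    (fun y p hp => funext fun i => hp.1.2.2.2 _ i (by omega)) (mem_evenPatterns_succ_iff z)
    fun y p hp => ?_
  rw [show 2 * (k + 1) = 2 * k + 1 + 1 from rfl, wSymp_update (by omega) (by omega) q hp.2 z,
    if_neg (by omega), neg_one_mul, neg_sub, Nat.add_sub_cancel]

theorem oddPatterns_finite_of_even {k : ℕ} (hfin : ∀ y, (evenPatterns k y).Finite)
    (z : Fin (k + 1) → ℤ) : (oddPatterns k z).Finite := by
  by_cases hz : W0 z
  · exact (oddPatterns_finite_and_SpOdd_eq hfin 0 (hz.2 0)).1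
  · simp [oddPatterns_eq_empty hz]

theorem evenPatterns_finite (k : ℕ) (z : Fin k → ℤ) : (evenPatterns k z).Finite := by
  induction k with
  | zero => simp [evenPatterns_zero]
  | succ k ih =>
    exact (evenPatterns_finite_and_SpEven_eq (oddPatterns_finite_of_even ih) 0 z).1

/-- Branching rule for `Sp^{2k+1}`. -/
theorem SpOdd_succ {k : ℕ} (q : ℕ → ℝ) {z : Fin (k + 1) → ℤ} (hz : 0 ≤ z 0) :
    SpOdd (k + 1) q z = ∑ y ∈ interlacingBox z, q k ^ (vsum z - vsum y) * SpEven k q y :=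
  (oddPatterns_finite_and_SpOdd_eq (evenPatterns_finite k) q hz).2

/-- Branching rule for `Sp^{2k+2}`. -/
theorem SpEven_succ {k : ℕ} (q : ℕ → ℝ) (z : Fin (k + 1) → ℤ) :
    SpEven (k + 1) q z =
      ∑ y ∈ interlacingBox (Fin.cons 0 z), q k ^ (vsum y - vsum z) * SpOdd (k + 1) q y :=
  (evenPatterns_finite_and_SpEven_eq (oddPatterns_finite_of_even (evenPatterns_finite k)) q z).2

theorem SpEven_zero (q : ℕ → ℝ) (z : Fin 0 → ℤ) : SpEven 0 q z = 1 := by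
  rw [SpEven_eq, evenPatterns_zero, finsum_mem_singleton]
  simp [wSymp]

theorem W0_cons_zero {k : ℕ} {z : Fin k → ℤ} (hz : W0 z) :
    W0 (Fin.cons 0 z : Fin (k + 1) → ℤ) := by
  constructor
  · intro i j hij
    induction i using Fin.cases with
    | zero =>
      induction j using Fin.cases with
      | zero => rfl
      | succ j => simpa using hz.2 j
    | succ i =>
      induction j using Fin.cases with
      | zero => simp at hij
      | succ j => simpa using hz.1 (Fin.succ_le_succ_iff.1 hij)
  · intro i
    induction i using Fin.cases with
    | zero => rfl
    | succ i => simpa using hz.2 i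

theorem W0_of_monotone_cons_zero {k : ℕ} {z : Fin k → ℤ}
    (hz : Monotone (Fin.cons 0 z : Fin (k + 1) → ℤ)) : W0 z :=
  ⟨fun i j hij => by simpa using hz (Fin.succ_le_succ_iff.2 hij),
    fun i => by simpa using hz (Fin.zero_le i.succ)⟩

theorem W0_of_mem_interlacingBox {k : ℕ} {w : Fin (k + 1) → ℤ} {y : Fin k → ℤ} (hw : W0 w)
    (hy : y ∈ interlacingBox w) : W0 y := by
  rw [mem_interlacingBox] at hy
  refine ⟨fun i j hij => ?_, fun i => (hw.2 _).trans (hy i).1⟩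
  rcases hij.eq_or_lt with rfl | hij
  · rfl
  · exact (hy i).2.trans ((hw.1 (Fin.le_def.2 (by simpa using hij))).trans (hy j).1)

theorem interlacingBox_nonempty {k : ℕ} {w : Fin (k + 1) → ℤ} (hw : Monotone w) :
    (interlacingBox w).Nonempty :=
  ⟨fun i => w i.castSucc, mem_interlacingBox.2 fun _ =>
    ⟨le_rfl, hw (Fin.castSucc_lt_succ).le⟩⟩

theorem SpOdd_eq_zero {k : ℕ} (q : ℕ → ℝ) {z : Fin (k + 1) → ℤ} (hz : ¬ W0 z) :
    SpOdd (k + 1) q z = 0 := by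
  rw [SpOdd_succ_eq, oddPatterns_eq_empty hz, finsum_mem_empty]

theorem SpEven_eq_zero {k : ℕ} (q : ℕ → ℝ) {z : Fin k → ℤ} (hz : ¬ W0 z) :
    SpEven k q z = 0 := by
  cases k with
  | zero => exact absurd ⟨fun i _ _ => i.elim0, fun i => i.elim0⟩ hz
  | succ k =>
    rw [SpEven_succ, interlacingBox_eq_empty fun h => hz (W0_of_monotone_cons_zero h),
      Finset.sum_empty]

theorem SpOdd_pos_of_even {k : ℕ} {q : ℕ → ℝ} (hq : ∀ i, 0 < q i)
    (h : ∀ y, W0 y → 0 < SpEven k q y) {z : Fin (k + 1) → ℤ} (hz : W0 z) :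
    0 < SpOdd (k + 1) q z := by
  rw [SpOdd_succ q (hz.2 0)]
  exact Finset.sum_pos (fun y hy => mul_pos (zpow_pos (hq k) _)
    (h y (W0_of_mem_interlacingBox hz hy))) (interlacingBox_nonempty hz.1)

theorem SpEven_pos {k : ℕ} {q : ℕ → ℝ} (hq : ∀ i, 0 < q i) {z : Fin k → ℤ} (hz : W0 z) :
    0 < SpEven k q z := by
  induction k with
  | zero => simp [SpEven_zero]
  | succ k ih =>
    rw [SpEven_succ]
    have hw := W0_cons_zero hz
    exact Finset.sum_pos (fun y hy => mul_pos (zpow_pos (hq k) _)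
      (SpOdd_pos_of_even hq (fun y hy => ih hy) (W0_of_mem_interlacingBox hw hy)))
      (interlacingBox_nonempty hw.1)

theorem SpOdd_pos {k : ℕ} {q : ℕ → ℝ} (hq : ∀ i, 0 < q i) {z : Fin (k + 1) → ℤ} (hz : W0 z) :
    0 < SpOdd (k + 1) q z :=
  SpOdd_pos_of_even hq (fun _ hy => SpEven_pos hq hy) hz

theorem boxSum_sub_single_zero {k : ℕ} {g : (Fin k → ℤ) → ℝ} (hg : ∀ y, ¬ W0 y → g y = 0)
    {w : Fin (k + 1) → ℤ} (h0 : w 0 = 0) :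
    boxSum g (w - Pi.single 0 1) = boxSum g w := by
  refine (Finset.sum_subset (fun y hy => mem_box_sub_zero hy) fun y hy hy' => hg y fun hW => ?_).symm
  refine hy' (mem_interlacingBox.2 fun l => ?_)
  have h := mem_interlacingBox.1 hy l
  simp only [Pi.sub_apply, Pi.single_apply, Fin.succ_ne_zero, if_false, sub_zero] at h
  refine ⟨?_, h.2⟩
  by_cases hl : l.castSucc = 0
  · rw [hl, h0]
    exact hW.2 l
  · simpa [hl] using h.1

theorem boxSum_cons_add_single_zero {k : ℕ} (g : (Fin (k + 1) → ℤ) → ℝ) (z : Fin (k + 1) → ℤ) :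
    boxSum g (Fin.cons 0 z + Pi.single 0 1) =
      ∑ y ∈ interlacingBox (Fin.cons 0 z), if 0 < y 0 then g y else 0 := by
  rw [← Finset.sum_filter]
  refine Finset.sum_congr (Finset.ext fun y => ?_) fun _ _ => rfl
  rw [Finset.mem_filter]
  constructor
  · intro h
    refine ⟨mem_box_of_mem_box_add_zero h, ?_⟩
    have := (mem_interlacingBox.1 h 0).1
    simp at this
    omega
  · rintro ⟨h, h'⟩
    refine mem_interlacingBox.2 fun l => ?_
    have := mem_interlacingBox.1 h l
    simp only [Pi.add_apply, Pi.single_apply, Fin.succ_ne_zero, if_false, add_zero]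
    refine ⟨?_, this.2⟩
    induction l using Fin.cases with
    | zero => simp; omega
    | succ l => simpa using this.1

theorem cons_zero_add_single {k : ℕ} (z : Fin k → ℤ) (i : Fin k) (a : ℤ) :
    (Fin.cons 0 (z + Pi.single i a) : Fin (k + 1) → ℤ) = Fin.cons 0 z + Pi.single i.succ a := by
  ext l
  induction l using Fin.cases <;> simp [Pi.single_apply]

theorem cons_zero_sub_single {k : ℕ} (z : Fin k → ℤ) (i : Fin k) (a : ℤ) :
    (Fin.cons 0 (z - Pi.single i a) : Fin (k + 1) → ℤ) = Fin.cons 0 z - Pi.single i.succ a := by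
  ext l
  induction l using Fin.cases <;> simp [Pi.single_apply]

/-- Intertwining step: an eigenvalue relation for `Sp^{2k}` gives one for `Sp^{2k+1}`. -/
theorem SpOdd_eigen_of_even {k : ℕ} {q : ℕ → ℝ} (hq : q k ≠ 0) {c : ℝ}
    (h : ∀ y : Fin k → ℤ, W0 y →
      ∑ i, (SpEven k q (y + Pi.single i 1) + SpEven k q (y - Pi.single i 1)) = c * SpEven k q y)
    {z : Fin (k + 1) → ℤ} (hz : W0 z) :
    ∑ i, (SpOdd (k + 1) q (z + Pi.single i 1) + SpOdd (k + 1) q (z - Pi.single i 1)) =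
      (c + (q k)⁻¹ * (if 0 < z 0 then 1 else 0) + q k) * SpOdd (k + 1) q z := by
  set g : (Fin k → ℤ) → ℝ := fun y => q k ^ (-vsum y) * SpEven k q y with hgdef
  have hg : ∀ y, ¬ W0 y → g y = 0 := fun y hy => by simp [hgdef, SpEven_eq_zero q hy]
  have hg' : ∀ y, ¬ Monotone y → g y = 0 := fun y hy => hg y fun h => hy h.1
  have hO : ∀ {z : Fin (k + 1) → ℤ}, 0 ≤ z 0 →
      SpOdd (k + 1) q z = q k ^ vsum z * boxSum g z := by
    intro z hz
    rw [SpOdd_succ q hz, boxSum, Finset.mul_sum]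
    refine Finset.sum_congr rfl fun y _ => ?_
    rw [hgdef, sub_eq_add_neg, zpow_add₀ hq, mul_assoc]
  have hplus : ∀ i, SpOdd (k + 1) q (z + Pi.single i 1) =
      q k ^ vsum z * (q k * boxSum g (z + Pi.single i 1)) := by
    intro i
    have h0 := hz.2 0
    rw [hO, vsum_add_single, zpow_add_one₀ hq, mul_assoc]
    simp only [Pi.add_apply, Pi.single_apply]
    split_ifs <;> omega
  have hminus : ∀ i, SpOdd (k + 1) q (z - Pi.single i 1) =
      q k ^ vsum z * ((q k)⁻¹ * boxSum g (z - Pi.single i 1)) -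
        if i = 0 then q k ^ vsum z * ((q k)⁻¹ * if 0 < z 0 then 0 else boxSum g z) else 0 := by
    intro i
    have h0 := hz.2 0
    by_cases hi : i = 0 ∧ z 0 = 0
    · obtain ⟨rfl, hz0⟩ := hi
      rw [SpOdd_eq_zero, boxSum_sub_single_zero hg hz0]
      · simp [hz0]
      · intro hW
        have := hW.2 0
        simp [hz0] at this
    · rw [hO, vsum_sub_single, zpow_sub_one₀ hq, mul_assoc]
      · have : (if i = 0 then q k ^ vsum z * ((q k)⁻¹ * if 0 < z 0 then 0 else boxSum g z)
            else 0) = 0 := by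
          by_cases hi0 : i = 0
          · rw [if_pos hi0, if_pos (lt_of_le_of_ne h0 fun h => hi ⟨hi0, h.symm⟩)]
            simp
          · rw [if_neg hi0]
        rw [this, sub_zero]
      · simp only [Pi.sub_apply, Pi.single_apply]
        split_ifs with h1
        · have : z 0 ≠ 0 := fun h => hi ⟨h1.symm, h⟩
          omega
        · omega
  have hshift : q k * ∑ y ∈ interlacingBox z, ∑ j, g (y + Pi.single j 1) +
      (q k)⁻¹ * ∑ y ∈ interlacingBox z, ∑ j, g (y - Pi.single j 1) = c * boxSum g z := by
    rw [boxSum, Finset.mul_sum, Finset.mul_sum, Finset.mul_sum, ← Finset.sum_add_distrib]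
    refine Finset.sum_congr rfl fun y hy => ?_
    have := h y (W0_of_mem_interlacingBox hz hy)
    rw [Finset.mul_sum, Finset.mul_sum, ← Finset.sum_add_distrib]
    simp only [hgdef, vsum_add_single, vsum_sub_single]
    rw [mul_left_comm, ← this, Finset.mul_sum]
    refine Finset.sum_congr rfl fun j _ => ?_
    rw [neg_add, neg_sub, ← sub_eq_add_neg, zpow_sub_one₀ hq, sub_eq_add_neg, add_comm 1,
      zpow_add_one₀ hq]
    field_simp
  simp only [hplus, hminus]
  rw [Finset.sum_add_distrib, Finset.sum_sub_distrib,
    Finset.sum_ite_eq' Finset.univ (0 : Fin (k + 1)), if_pos (Finset.mem_univ _), ← Finset.mul_sum, ← Finset.mul_sum, ← Finset.mul_sum,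
    ← Finset.mul_sum, sum_boxSum_add_single hg' hz.1, sum_boxSum_sub_single hg' hz.1,
    hO (hz.2 0)]
  split_ifs <;> linear_combination q k ^ vsum z * hshift

/-- Intertwining step: an eigenvalue relation for `Sp^{2k+1}` gives one for `Sp^{2k+2}`. -/
theorem SpEven_eigen_of_odd {k : ℕ} {q : ℕ → ℝ} (hq : q k ≠ 0) {c : ℝ}
    (h : ∀ y : Fin (k + 1) → ℤ, W0 y →
      ∑ i, (SpOdd (k + 1) q (y + Pi.single i 1) + SpOdd (k + 1) q (y - Pi.single i 1)) =
        (c + (q k)⁻¹ * (if 0 < y 0 then 1 else 0) + q k) * SpOdd (k + 1) q y)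
    {z : Fin (k + 1) → ℤ} (hz : W0 z) :
    ∑ i, (SpEven (k + 1) q (z + Pi.single i 1) + SpEven (k + 1) q (z - Pi.single i 1)) =
      (c + (q k + (q k)⁻¹)) * SpEven (k + 1) q z := by
  set g : (Fin (k + 1) → ℤ) → ℝ := fun y => q k ^ vsum y * SpOdd (k + 1) q y with hgdef
  have hg : ∀ y, ¬ W0 y → g y = 0 := fun y hy => by simp [hgdef, SpOdd_eq_zero q hy]
  have hg' : ∀ y, ¬ Monotone y → g y = 0 := fun y hy => hg y fun h => hy h.1
  set w : Fin (k + 2) → ℤ := Fin.cons 0 z with hwdef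
  have hw : W0 w := W0_cons_zero hz
  have hE : ∀ z : Fin (k + 1) → ℤ,
      SpEven (k + 1) q z = q k ^ (-vsum z) * boxSum g (Fin.cons 0 z) := by
    intro z
    rw [SpEven_succ, boxSum, Finset.mul_sum]
    refine Finset.sum_congr rfl fun y _ => ?_
    rw [hgdef, sub_eq_neg_add, zpow_add₀ hq, mul_assoc]
  have hplus : ∀ i, SpEven (k + 1) q (z + Pi.single i 1) =
      q k ^ (-vsum z) * ((q k)⁻¹ * boxSum g (w + Pi.single i.succ 1)) := by
    intro i
    rw [hE, vsum_add_single, neg_add, ← sub_eq_add_neg, zpow_sub_one₀ hq, mul_assoc,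
      cons_zero_add_single]
  have hminus : ∀ i, SpEven (k + 1) q (z - Pi.single i 1) =
      q k ^ (-vsum z) * (q k * boxSum g (w - Pi.single i.succ 1)) := by
    intro i
    rw [hE, vsum_sub_single, neg_sub, sub_eq_neg_add, zpow_add_one₀ hq, mul_assoc,
      cons_zero_sub_single]
  have hshift : (q k)⁻¹ * ∑ y ∈ interlacingBox w, ∑ j, g (y + Pi.single j 1) +
      q k * ∑ y ∈ interlacingBox w, ∑ j, g (y - Pi.single j 1) =
        (c + q k) * boxSum g w + (q k)⁻¹ * boxSum g (w + Pi.single 0 1) := by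
    rw [boxSum_cons_add_single_zero, boxSum, Finset.mul_sum, Finset.mul_sum, Finset.mul_sum,
      Finset.mul_sum, ← Finset.sum_add_distrib, ← Finset.sum_add_distrib]
    refine Finset.sum_congr rfl fun y hy => ?_
    have := h y (W0_of_mem_interlacingBox hw hy)
    trans q k ^ vsum y * ∑ i, (SpOdd (k + 1) q (y + Pi.single i 1) +
      SpOdd (k + 1) q (y - Pi.single i 1))
    · rw [Finset.mul_sum, Finset.mul_sum, Finset.mul_sum, ← Finset.sum_add_distrib]
      simp only [hgdef, vsum_add_single, vsum_sub_single]
      refine Finset.sum_congr rfl fun j _ => ?_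
      rw [zpow_sub_one₀ hq, zpow_add_one₀ hq]
      field_simp
    · rw [this, hgdef]
      split_ifs <;> ring
  have hadd := sum_boxSum_add_single hg' hw.1
  have hsub := sum_boxSum_sub_single hg' hw.1
  rw [Fin.sum_univ_succ] at hadd hsub
  rw [boxSum_sub_single_zero hg rfl] at hsub
  simp only [hplus, hminus]
  rw [Finset.sum_add_distrib, ← Finset.mul_sum, ← Finset.mul_sum, ← Finset.mul_sum,
    ← Finset.mul_sum, hE z]
  linear_combination q k ^ (-vsum z) * (hshift + (q k)⁻¹ * hadd + q k * hsub)

theorem SpEven_eigen {q : ℕ → ℝ} (hq : ∀ i, q i ≠ 0) (k : ℕ) {z : Fin k → ℤ} (hz : W0 z) :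
    ∑ i, (SpEven k q (z + Pi.single i 1) + SpEven k q (z - Pi.single i 1)) =
      (∑ i ∈ Finset.range k, (q i + (q i)⁻¹)) * SpEven k q z := by
  induction k with
  | zero => simp
  | succ k ih =>
    rw [Finset.sum_range_succ]
    exact SpEven_eigen_of_odd (hq k) (fun y hy => SpOdd_eigen_of_even (hq k) (fun y hy => ih hy) hy)
      hz

theorem SpOdd_eigen {q : ℕ → ℝ} (hq : ∀ i, q i ≠ 0) (k : ℕ) {z : Fin (k + 1) → ℤ} (hz : W0 z) :
    ∑ i, (SpOdd (k + 1) q (z + Pi.single i 1) + SpOdd (k + 1) q (z - Pi.single i 1)) =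
      (∑ i ∈ Finset.range k, (q i + (q i)⁻¹) + (q k)⁻¹ * (if 0 < z 0 then 1 else 0) + q k) *
        SpOdd (k + 1) q z :=
  SpOdd_eigen_of_even (hq k) (fun _ hy => SpEven_eigen hq k hy) hz

open Classical in
/-- The Doob transform of the nearest-neighbour walk by an eigenfunction vanishing off `W0`
has zero row sums. -/
theorem finsum_doob_eq_zero {k : ℕ} {F : (Fin k → ℤ) → ℝ} (hF : ∀ z, ¬ W0 z → F z = 0)
    {x : Fin k → ℤ} (hx : W0 x) (hFx : F x ≠ 0) {d : ℝ}
    (hd : ∑ i, (F (x + Pi.single i 1) + F (x - Pi.single i 1)) = d * F x) :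
    ∑ᶠ x' ∈ {x' : Fin k → ℤ | W0 x'},
      (if x' = x then -d
        else if (∃ i, x' = x + Pi.single i 1 ∨ x' = x - Pi.single i 1) ∧ W0 x' then F x' / F x
        else 0) = 0 := by
  set Q : (Fin k → ℤ) → ℝ := fun x' => if x' = x then -d
        else if (∃ i, x' = x + Pi.single i 1 ∨ x' = x - Pi.single i 1) ∧ W0 x' then F x' / F x
        else 0 with hQ
  set s₁ : Finset (Fin k → ℤ) := Finset.univ.image fun i => x + Pi.single i 1 with hs₁
  set s₂ : Finset (Fin k → ℤ) := Finset.univ.image fun i => x - Pi.single i 1 with hs₂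
  have hne : ∀ i, x + Pi.single i 1 ≠ x := fun i h => by simpa using congrFun h i
  have hne' : ∀ i, x - Pi.single i 1 ≠ x := fun i h => by simpa using congrFun h i
  have hx₁ : x ∉ s₁ ∪ s₂ := by
    simp only [hs₁, hs₂, Finset.mem_union, Finset.mem_image, Finset.mem_univ, true_and, not_or,
      not_exists]
    exact ⟨hne, hne'⟩
  have hdisj : Disjoint s₁ s₂ := by
    refine Finset.disjoint_left.2 fun y h₁ h₂ => ?_
    simp only [hs₁, hs₂, Finset.mem_image, Finset.mem_univ, true_and] at h₁ h₂
    obtain ⟨i, rfl⟩ := h₁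
    obtain ⟨j, hj⟩ := h₂
    have := congrFun hj i
    simp only [Pi.add_apply, Pi.sub_apply, Pi.single_apply] at this
    split_ifs at this <;> omega
  have hinj : Function.Injective fun i : Fin k => (Pi.single i 1 : Fin k → ℤ) := by
    intro i j hij
    by_contra hne
    simpa [Pi.single_apply, hne] using congrFun hij i
  have hval : ∀ y ∈ s₁ ∪ s₂, Q y = F y / F x := by
    intro y hy
    have hyx : y ≠ x := fun h => hx₁ (h ▸ hy)
    have hy' : ∃ i, y = x + Pi.single i 1 ∨ y = x - Pi.single i 1 := by
      simp only [hs₁, hs₂, Finset.mem_union, Finset.mem_image, Finset.mem_univ, true_and] at hy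
      rcases hy with ⟨i, rfl⟩ | ⟨i, rfl⟩
      exacts [⟨i, .inl rfl⟩, ⟨i, .inr rfl⟩]
    simp only [hQ, if_neg hyx, hy', true_and]
    split_ifs with hW
    · rfl
    · rw [hF y hW, zero_div]
  have hsupp : ∀ y, Q y ≠ 0 → (W0 y ↔ y ∈ insert x (s₁ ∪ s₂)) := by
    intro y hy
    have key : W0 y ∧ y ∈ insert x (s₁ ∪ s₂) := by
      by_cases hyx : y = x
      · exact ⟨hyx ▸ hx, by simp [hyx]⟩
      · simp only [hQ, if_neg hyx] at hy
        by_cases h : (∃ i, y = x + Pi.single i 1 ∨ y = x - Pi.single i 1) ∧ W0 y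
        · refine ⟨h.2, Finset.mem_insert_of_mem ?_⟩
          obtain ⟨⟨i, rfl | rfl⟩, -⟩ := h
          · exact Finset.mem_union_left _ (Finset.mem_image_of_mem _ (Finset.mem_univ i))
          · exact Finset.mem_union_right _ (Finset.mem_image_of_mem _ (Finset.mem_univ i))
        · exact absurd (if_neg h) hy
    exact iff_of_true key.1 key.2
  rw [finsum_mem_eq_sum_of_inter_support_eq Q (t := insert x (s₁ ∪ s₂)),
    Finset.sum_insert hx₁, Finset.sum_congr rfl hval, ← Finset.sum_div, Finset.sum_union hdisj,
    hs₁, hs₂, Finset.sum_image fun i _ j _ h => hinj (add_right_injective x h),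
    Finset.sum_image fun i _ j _ h => hinj (sub_right_injective h), ← Finset.sum_add_distrib, hd]
  · simp [hQ, hFx]
  · ext y
    simp only [Set.mem_inter_iff, Set.mem_ofPred_eq, Function.mem_support, Finset.mem_coe]
    exact and_congr_left (hsupp y)

/-- Conservativity of the symplectic `Q`-matrices: for every `k ≥ 1` (here `k = m+1`)
and `q ∈ (0,1)^k`, both `Q_{2k−1}` and `Q_{2k}` are conservative `Q`-matrices on `W₀^k`:
off-diagonal entries are nonnegative and every row sums to zero. -/
theorem wall_Qmatrices_conservative (m : ℕ) (q : ℕ → ℝ)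
    (hq : ∀ i, 0 < q i ∧ q i < 1) :
    (∀ x x' : Fin (m + 1) → ℤ, W0 x → W0 x' → x' ≠ x → 0 ≤ Qodd m q x x') ∧
    (∀ x : Fin (m + 1) → ℤ, W0 x →
      ∑ᶠ x' ∈ {x' : Fin (m + 1) → ℤ | W0 x'}, Qodd m q x x' = 0) ∧
    (∀ x x' : Fin (m + 1) → ℤ, W0 x → W0 x' → x' ≠ x → 0 ≤ Qeven m q x x') ∧
    (∀ x : Fin (m + 1) → ℤ, W0 x →
      ∑ᶠ x' ∈ {x' : Fin (m + 1) → ℤ | W0 x'}, Qeven m q x x' = 0) := by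
  have hpos : ∀ i, 0 < q i := fun i => (hq i).1
  have hne : ∀ i, q i ≠ 0 := fun i => (hpos i).ne'
  refine ⟨fun x x' hx hx' hxx' => ?_, fun x hx => ?_, fun x x' hx hx' hxx' => ?_, fun x hx => ?_⟩
  · rw [Qodd, if_neg hxx']
    split_ifs
    · exact (div_pos (SpOdd_pos hpos hx') (SpOdd_pos hpos hx)).le
    · exact le_rfl
  · exact finsum_doob_eq_zero (fun z => SpOdd_eq_zero q) hx (SpOdd_pos hpos hx).ne'
      (SpOdd_eigen hne m hx)
  · rw [Qeven, if_neg hxx']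
    split_ifs
    · exact (div_pos (SpEven_pos hpos hx') (SpEven_pos hpos hx)).le
    · exact le_rfl
  · exact finsum_doob_eq_zero (fun z => SpEven_eq_zero q) hx (SpEven_pos hpos hx).ne'
      (SpEven_eigen hne (m + 1) hx)

end
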